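/- For n ≥ 4, if an element w of M_n is the image of a word over the alphabet {x, s_1, …, s_{n−1}} that is equal to its own reverse, then w³ = w and w² is idempotent. -/

import Mathlib

/-! Words over the alphabet `{x, s₁, …, s_{n-1}}` of the presentation of the dual
symmetric inverse monoid, encoded as `FreeMonoid (Fin n)` with letter `0 = x` and
letter `i = sᵢ` for `1 ≤ i ≤ n - 1`. -/

/-- The letter `x`. -/
def xw (n : ℕ) : FreeMonoid (Fin n) :=
  if h : 0 < n then FreeMonoid.of ⟨0, h⟩ else 1

/-- The letter `sᵢ` (for `1 ≤ i ≤ n - 1`; junk value `1` otherwise). -/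
def sw (n : ℕ) (i : ℕ) : FreeMonoid (Fin n) :=
  if h : i < n then FreeMonoid.of ⟨i, h⟩ else 1

/-- The word `σ = s₂ s₃ s₁ s₂`. -/
def σw (n : ℕ) : FreeMonoid (Fin n) := sw n 2 * sw n 3 * sw n 1 * sw n 2

/-- The exponent `m_{ij}`: `1` if `i = j`, `3` if `|i - j| = 1`, and `2` if
`|i - j| > 1`. -/
def mExp (i j : ℕ) : ℕ :=
  if i = j then 1 else if j - i = 1 ∨ i - j = 1 then 3 else 2

/-- The words `l₂ = x s₂ s₁` and `l_{i+1} = s_{i+1} lᵢ s_{i+1} sᵢ` (junk value `1`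
for `i < 2`). -/
def lw (n : ℕ) : ℕ → FreeMonoid (Fin n)
  | 0 => 1
  | 1 => 1
  | 2 => xw n * sw n 2 * sw n 1
  | (i + 3) => sw n (i + 3) * lw n (i + 2) * sw n (i + 3) * sw n (i + 2)

/-- The words `y₃ = x` and `y_{i+1} = lᵢ yᵢ sᵢ` (junk value `1` for `i < 3`). -/
def yw (n : ℕ) : ℕ → FreeMonoid (Fin n)
  | 0 => 1
  | 1 => 1
  | 2 => 1
  | 3 => xw n
  | (i + 4) => lw n (i + 3) * yw n (i + 3) * sw n (i + 3)

/-- The defining relations (R1)–(R7) of the monoid `Mₙ`.  Any relation involving a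
generator `sᵢ` with `i > n - 1` is omitted (this is the role of the hypotheses
bounding the indices, and of `4 ≤ n` in (R5), which involves `s₃`). -/
inductive MRel (n : ℕ) : FreeMonoid (Fin n) → FreeMonoid (Fin n) → Prop
  | r1 {i j : ℕ} : 1 ≤ i → i ≤ j → j ≤ n - 1 →
      MRel n ((sw n i * sw n j) ^ mExp i j) 1
  | r2 : MRel n (xw n ^ 3) (xw n)
  | r3a : MRel n (xw n * sw n 1) (xw n)
  | r3b : MRel n (sw n 1 * xw n) (xw n)
  | r4a : MRel n (xw n * sw n 2 * xw n) (xw n * sw n 2 * xw n * sw n 2)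
  | r4b : MRel n (xw n * sw n 2 * xw n) (sw n 2 * xw n * sw n 2 * xw n)
  | r4c : MRel n (xw n * sw n 2 * xw n) (xw n * sw n 2 * xw n ^ 2)
  | r4d : MRel n (xw n * sw n 2 * xw n) (xw n ^ 2 * sw n 2 * xw n)
  | r5a : 4 ≤ n →
      MRel n (xw n ^ 2 * σw n * xw n ^ 2 * σw n) (σw n * xw n ^ 2 * σw n * xw n ^ 2)
  | r5b : 4 ≤ n →
      MRel n (xw n ^ 2 * σw n * xw n ^ 2 * σw n) (xw n * sw n 2 * sw n 3 * sw n 2 * xw n)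
  | r6 {i : ℕ} : 3 ≤ i → i ≤ n - 1 →
      MRel n (yw n i * sw n i * yw n i) (sw n i * yw n i * sw n i)
  | r7 {i : ℕ} : 4 ≤ i → i ≤ n - 1 →
      MRel n (xw n * sw n i) (sw n i * xw n)

/-- The monoid congruence generated by the relations (R1)–(R7). -/
def Mcon (n : ℕ) : Con (FreeMonoid (Fin n)) := conGen (MRel n)

/-- The monoid `Mₙ` presented by generators `x, s₁, …, s_{n-1}` and relations
(R1)–(R7). -/
abbrev M (n : ℕ) := (Mcon n).Quotient

/-- The generator `x` of `Mₙ`. -/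
def xm (n : ℕ) : M n := (Mcon n).mk' (xw n)

/-- The generator `sᵢ` of `Mₙ`. -/
def sm (n : ℕ) (i : ℕ) : M n := (Mcon n).mk' (sw n i)

/-- The element `σ = s₂ s₃ s₁ s₂` of `Mₙ`. -/
def σm (n : ℕ) : M n := (Mcon n).mk' (σw n)

/-- The relations of the dual symmetric inverse monoid used below, for an element `x` and units
`r 0, …, r (n - 2)` of an arbitrary monoid, `r i` standing for the generator `s_{i+1}`. -/
structure DualSymRelations {N : Type*} [Monoid N] (n : ℕ) (x : N) (r : ℕ → Nˣ) : Prop where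
  four_le : 4 ≤ n
  sq : ∀ i, i + 1 < n → r i * r i = 1
  comm : ∀ i j, i + 2 ≤ j → j + 1 < n → r i * r j = r j * r i
  braid : ∀ i, i + 2 < n → r i * r (i + 1) * r i = r (i + 1) * r i * r (i + 1)
  x_cube : x * (x * x) = x
  x_r0 : x * r 0 = x
  r0_x : r 0 * x = x
  xrx_r : x * r 1 * x * r 1 = x * r 1 * x
  r_xrx : r 1 * (x * r 1 * x) = x * r 1 * x
  xrx_x : x * r 1 * x * x = x * r 1 * x
  x_xrx : x * (x * r 1 * x) = x * r 1 * x
  disjoint_comm : x * x * (r 1 * r 2 * r 0 * r 1) * (x * x) * (r 1 * r 2 * r 0 * r 1)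
    = (r 1 * r 2 * r 0 * r 1) * (x * x) * (r 1 * r 2 * r 0 * r 1) * (x * x)
  disjoint_eq : x * x * (r 1 * r 2 * r 0 * r 1) * (x * x) * (r 1 * r 2 * r 0 * r 1)
    = x * r 1 * r 2 * r 1 * x
  x_braid : x * r 2 * x = r 2 * x * r 2
  x_comm : ∀ i, 3 ≤ i → i + 1 < n → x * r i = r i * x

namespace DualSymRelations

open Equiv

variable {N : Type*} [Monoid N] {n : ℕ} {x : N} {r : ℕ → Nˣ}

/-- The unit `r i` paired with the adjacent transposition it stands for. -/
def gen (r : ℕ → Nˣ) (i : ℕ) : Nˣ × Perm ℕ := (r i, swap i (i + 1))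

/-- The subgroup generated by the pairs `gen r i` with `k ≤ i`. -/
def tailSubgroup (n : ℕ) (r : ℕ → Nˣ) (k : ℕ) : Subgroup (Nˣ × Perm ℕ) :=
  Subgroup.closure {g | ∃ i, k ≤ i ∧ i + 1 < n ∧ g = gen r i}

lemma gen_mem {k i : ℕ} (hk : k ≤ i) (hi : i + 1 < n) : gen r i ∈ tailSubgroup n r k :=
  Subgroup.subset_closure ⟨i, hk, hi, rfl⟩

lemma gen_sq (H : DualSymRelations n x r) {i : ℕ} (hi : i + 1 < n) : gen r i * gen r i = 1 := by
  simp [gen, Prod.ext_iff, H.sq i hi]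

lemma gen_inv (H : DualSymRelations n x r) {i : ℕ} (hi : i + 1 < n) : (gen r i)⁻¹ = gen r i :=
  inv_eq_of_mul_eq_one_left (H.gen_sq hi)

lemma gen_comm (H : DualSymRelations n x r) {i j : ℕ} (hij : i + 2 ≤ j) (hj : j + 1 < n) :
    gen r i * gen r j = gen r j * gen r i := by
  refine Prod.ext (H.comm i j hij hj) (Equiv.ext fun a => ?_)
  simp only [gen, Prod.snd_mul, Perm.mul_apply, swap_apply_def]
  split_ifs <;> omega

lemma gen_braid (H : DualSymRelations n x r) {i : ℕ} (hi : i + 2 < n) :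
    gen r i * gen r (i + 1) * gen r i = gen r (i + 1) * gen r i * gen r (i + 1) := by
  refine Prod.ext (H.braid i hi) (Equiv.ext fun a => ?_)
  simp only [gen, Prod.snd_mul, Perm.mul_apply, swap_apply_def]
  split_ifs <;> omega

/-- The coset representative `gen k * gen (k + 1) * ⋯ * gen (k + m - 1)`. -/
def cyc (r : ℕ → Nˣ) (k : ℕ) : ℕ → Nˣ × Perm ℕ
  | 0 => 1
  | m + 1 => cyc r k m * gen r (k + m)

lemma cyc_mul_gen_far (H : DualSymRelations n x r) {k j : ℕ} (hj : j + 1 < n) (m : ℕ)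
    (hm : k + m + 1 ≤ j) : cyc r k m * gen r j = gen r j * cyc r k m := by
  induction m with
  | zero => simp [cyc]
  | succ m ih =>
    rw [cyc, mul_assoc, H.gen_comm (by omega) hj, ← mul_assoc, ih (by omega), mul_assoc]

lemma cyc_mul_gen_near (H : DualSymRelations n x r) {k j : ℕ} (hk : k ≤ j) (m : ℕ)
    (hm : j + 2 ≤ k + m) (hn : k + m < n) :
    cyc r k m * gen r j = gen r (j + 1) * cyc r k m := by
  induction m with
  | zero => omega
  | succ m ih =>
    rcases (show j + 2 ≤ k + m ∨ j + 1 = k + m by omega) with h | h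
    · rw [cyc, mul_assoc, ← H.gen_comm h (by omega), ← mul_assoc, ih h (by omega), mul_assoc]
    · obtain ⟨m, rfl⟩ : ∃ m', m = m' + 1 := ⟨m - 1, by omega⟩
      obtain rfl : j = k + m := by omega
      have hb := H.gen_braid (i := k + m) (by omega)
      have hf := H.cyc_mul_gen_far (k := k) (j := k + m + 1) (by omega) m (by omega)
      simp only [cyc, ← add_assoc] at *
      rw [mul_assoc, mul_assoc, ← mul_assoc (gen r (k + m)), hb, ← mul_assoc, ← mul_assoc, hf]
      simp only [mul_assoc]

lemma exists_eq_mul_cyc (H : DualSymRelations n x r) {k : ℕ} (hk : k < n) {g : Nˣ × Perm ℕ}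
    (hg : g ∈ tailSubgroup n r k) :
    ∃ w ∈ tailSubgroup n r (k + 1), ∃ m, k + m < n ∧ g = w * cyc r k m := by
  have step : ∀ g, (∃ w ∈ tailSubgroup n r (k + 1), ∃ m, k + m < n ∧ g = w * cyc r k m) →
      ∀ j, k ≤ j → j + 1 < n →
      ∃ w ∈ tailSubgroup n r (k + 1), ∃ m, k + m < n ∧ g * gen r j = w * cyc r k m := by
    rintro _ ⟨w, hw, m, hm, rfl⟩ j hkj hj
    rcases (show j + 2 ≤ k + m ∨ j + 1 = k + m ∨ j = k + m ∨ k + m + 1 ≤ j by omega)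
      with h | h | h | h
    · exact ⟨w * gen r (j + 1), mul_mem hw (gen_mem (by omega) (by omega)), m, hm, by
        rw [mul_assoc, H.cyc_mul_gen_near hkj m h hm, mul_assoc]⟩
    · obtain ⟨m, rfl⟩ : ∃ m', m = m' + 1 := ⟨m - 1, by omega⟩
      obtain rfl : j = k + m := by omega
      exact ⟨w, hw, m, by omega, by rw [cyc, mul_assoc, mul_assoc, H.gen_sq hj, mul_one]⟩
    · exact ⟨w, hw, m + 1, by omega, by rw [cyc, mul_assoc, h]⟩
    · exact ⟨w * gen r j, mul_mem hw (gen_mem (by omega) hj), m, hm, by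
        rw [mul_assoc, H.cyc_mul_gen_far hj m h, mul_assoc]⟩
  induction hg using Subgroup.closure_induction_right with
  | one => exact ⟨1, one_mem _, 0, hk, by simp [cyc]⟩
  | mul_right g hg y hy ih =>
    obtain ⟨j, hkj, hj, rfl⟩ := hy
    exact step _ ih j hkj hj
  | mul_inv_cancel g hg y hy ih =>
    obtain ⟨j, hkj, hj, rfl⟩ := hy
    rw [H.gen_inv hj]
    exact step _ ih j hkj hj

lemma cyc_apply (k m : ℕ) : (cyc r k m).2 (k + m) = k := by
  induction m with
  | zero => simp [cyc]
  | succ m ih => simp [cyc, gen, ← add_assoc, ih]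

lemma apply_of_mem_tailSubgroup {k a : ℕ} (ha : a < k) {g : Nˣ × Perm ℕ}
    (hg : g ∈ tailSubgroup n r k) : g.2 a = a := by
  have : tailSubgroup n r k ≤
      (MulAction.stabilizer (Perm ℕ) a).comap (MonoidHom.snd Nˣ (Perm ℕ)) := by
    refine (Subgroup.closure_le _).2 ?_
    rintro _ ⟨i, hi, -, rfl⟩
    exact swap_apply_of_ne_of_ne (by omega) (by omega)
  exact this hg

lemma mem_tailSubgroup_of_fixes (H : DualSymRelations n x r) {g : Nˣ × Perm ℕ}
    (hg : g ∈ tailSubgroup n r 0) (k : ℕ) (hk : k ≤ n) (hfix : ∀ a < k, g.2 a = a) :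
    g ∈ tailSubgroup n r k := by
  induction k with
  | zero => exact hg
  | succ k ih =>
    obtain ⟨w, hw, m, hm, rfl⟩ :=
      H.exists_eq_mul_cyc (by omega) (ih (by omega) fun a ha => hfix a (by omega))
    have h1 : (w * cyc r k m).2 (k + m) = k := by
      rw [Prod.snd_mul, Perm.mul_apply, cyc_apply, apply_of_mem_tailSubgroup (by omega) hw]
    have h2 : k + m = k := (w * cyc r k m).2.injective (h1.trans (hfix k (by omega)).symm)
    obtain rfl : m = 0 := by omega
    simpa [cyc] using hw

lemma exists_swap {a b : ℕ} (ha : a < n) (hb : b < n) :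
    ∃ g ∈ tailSubgroup n r 0, g.2 = swap a b := by
  wlog hab : a ≤ b generalizing a b
  · obtain ⟨g, hg, e⟩ := this hb ha (by omega)
    exact ⟨g, hg, e.trans (swap_comm _ _)⟩
  induction b, hab using Nat.le_induction with
  | base => exact ⟨1, one_mem _, (swap_self a).symm⟩
  | succ b hab ih =>
    obtain ⟨g, hg, e⟩ := ih (by omega)
    have hgen : gen r b ∈ tailSubgroup n r 0 := gen_mem (by omega) hb
    rcases hab.eq_or_lt with rfl | hlt
    · exact ⟨_, hgen, rfl⟩
    · refine ⟨gen r b * g * gen r b, mul_mem (mul_mem hgen hg) hgen, ?_⟩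
      rw [Prod.snd_mul, Prod.snd_mul, e]
      refine Equiv.ext fun c => ?_
      simp only [gen, Perm.mul_apply, swap_apply_def]
      split_ifs <;> omega

lemma apply_lt {g : Nˣ × Perm ℕ} (hg : g ∈ tailSubgroup n r 0) {a : ℕ} (ha : a < n) :
    g.2 a < n := by
  induction hg using Subgroup.closure_induction_left generalizing a with
  | one => exact ha
  | mul_left y hy g hg ih =>
    obtain ⟨j, -, hj, rfl⟩ := hy
    have := ih ha
    simp only [gen, Prod.snd_mul, Perm.mul_apply, swap_apply_def]
    split_ifs <;> omega
  | inv_mul_cancel y hy g hg ih =>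
    obtain ⟨j, -, hj, rfl⟩ := hy
    have := ih ha
    simp only [gen, Prod.snd_mul, Prod.snd_inv, swap_inv, Perm.mul_apply, swap_apply_def]
    split_ifs <;> omega

lemma exists_map_zero_one {i j : ℕ} (hi : i < n) (hj : j < n) (hij : i ≠ j) :
    ∃ g ∈ tailSubgroup n r 0, g.2 0 = i ∧ g.2 1 = j := by
  obtain ⟨g, hg, eg⟩ := exists_swap (r := r) (show 0 < n by omega) hi
  have hne : swap 0 i j ≠ 0 := by
    rw [Ne, swap_apply_eq_iff, swap_apply_left]; exact hij.symm
  have hlt : swap 0 i j < n := eg ▸ apply_lt hg hj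
  obtain ⟨h, hh, eh⟩ := exists_swap (r := r) (show 1 < n by omega) hlt
  refine ⟨g * h, mul_mem hg hh, ?_, ?_⟩
  · simp [eg, eh, swap_apply_of_ne_of_ne zero_ne_one hne.symm]
  · simp [eg, eh]

/-- The elements commuting with a fixed `y`, as a subgroup of the pairs. -/
def commutant (y : N) : Subgroup (Nˣ × Perm ℕ) where
  carrier := {g | Commute (g.1 : N) y}
  one_mem' := by simp
  mul_mem' {a b} ha hb := by
    simpa using Commute.mul_left (show Commute (a.1 : N) y from ha) hb
  inv_mem' {a} ha := Commute.units_inv_left ha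

lemma commute_x (H : DualSymRelations n x r) {g : Nˣ × Perm ℕ} (hg : g ∈ tailSubgroup n r 0)
    (hfix : ∀ a < 3, g.2 a = a) : Commute (g.1 : N) x := by
  have h : tailSubgroup n r 3 ≤ commutant x := by
    refine (Subgroup.closure_le _).2 ?_
    rintro _ ⟨i, hi, hn, rfl⟩
    exact (H.x_comm i hi hn).symm
  exact h (H.mem_tailSubgroup_of_fixes hg 3 (by have := H.four_le; omega) hfix)

lemma r_sq (H : DualSymRelations n x r) {i : ℕ} (hi : i + 1 < n) : (r i : N) * r i = 1 := by
  exact_mod_cast congrArg Units.val (H.sq i hi)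

lemma r_mul_cancel (H : DualSymRelations n x r) {i : ℕ} (hi : i + 1 < n) (y : N) :
    (r i : N) * (r i * y) = y := by
  rw [← mul_assoc, H.r_sq hi, one_mul]

lemma r_inv (H : DualSymRelations n x r) {i : ℕ} (hi : i + 1 < n) : (r i)⁻¹ = r i :=
  inv_eq_of_mul_eq_one_left (H.sq i hi)

lemma x_r2_x_r2 (H : DualSymRelations n x r) : x * r 2 * x * r 2 = r 2 * x := by
  rw [H.x_braid, mul_assoc, H.r_sq (by have := H.four_le; omega), mul_one]

lemma r2_x_r2_x (H : DualSymRelations n x r) : r 2 * x * r 2 * x = x * r 2 := by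
  have h := H.x_braid
  simp only [mul_assoc] at h ⊢
  rw [h, H.r_mul_cancel (by have := H.four_le; omega)]

lemma sq_r2 (H : DualSymRelations n x r) : Commute (r 2 : N) (x * x) := by
  have h1 : x * x * r 2 * x = r 2 * x := by
    rw [mul_assoc x x, mul_assoc x, H.x_braid, ← mul_assoc, ← mul_assoc, H.x_r2_x_r2]
  have h2 : x * r 2 * x * x = x * r 2 := by rw [H.x_braid, H.r2_x_r2_x]
  calc (r 2 : N) * (x * x) = x * x * r 2 * x * x := by rw [h1, mul_assoc]
    _ = x * (x * r 2 * x * x) := by simp only [mul_assoc]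
    _ = x * x * r 2 := by rw [h2, mul_assoc]

lemma commute_sq (H : DualSymRelations n x r) {g : Nˣ × Perm ℕ} (hg : g ∈ tailSubgroup n r 0)
    (h0 : g.2 0 = 0) (h1 : g.2 1 = 1) : Commute (g.1 : N) (x * x) := by
  have h : tailSubgroup n r 2 ≤ commutant (x * x) := by
    refine (Subgroup.closure_le _).2 ?_
    rintro _ ⟨i, hi, hn, rfl⟩
    rcases hi.eq_or_lt with rfl | hi
    · exact H.sq_r2
    · have : Commute (r i : N) x := (H.x_comm i hi hn).symm
      exact this.mul_right this
  refine h (H.mem_tailSubgroup_of_fixes hg 2 (by have := H.four_le; omega) fun a ha => ?_)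
  interval_cases a <;> assumption

/-- Conjugation of an element by the unit component of a pair. -/
def conj (g : Nˣ × Perm ℕ) (y : N) : N := g.1 * y * (g.1⁻¹ : Nˣ)

lemma conj_mul (g h : Nˣ × Perm ℕ) (y : N) : conj (g * h) y = conj g (conj h y) := by
  simp [conj, mul_assoc]

lemma conj_mul_apply (g : Nˣ × Perm ℕ) (y z : N) : conj g (y * z) = conj g y * conj g z := by
  simp [conj, mul_assoc]

lemma conj_of_commute {g : Nˣ × Perm ℕ} {y : N} (h : Commute (g.1 : N) y) : conj g y = y := by
  rw [conj, h.eq, mul_assoc, Units.mul_inv, mul_one]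

lemma conj_gen (H : DualSymRelations n x r) {i : ℕ} (hi : i + 1 < n) (y : N) :
    conj (gen r i) y = r i * y * r i := by
  rw [conj, gen, H.r_inv hi]

open Classical in
/-- The idempotent joining the points `i` and `j`. -/
noncomputable def join (n : ℕ) (x : N) (r : ℕ → Nˣ) (i j : ℕ) : N :=
  if h : ∃ g ∈ tailSubgroup n r 0, g.2 0 = i ∧ g.2 1 = j then conj h.choose (x * x) else 1

lemma join_eq (H : DualSymRelations n x r) {g : Nˣ × Perm ℕ} (hg : g ∈ tailSubgroup n r 0) :
    join n x r (g.2 0) (g.2 1) = conj g (x * x) := by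
  have h : ∃ h ∈ tailSubgroup n r 0, h.2 0 = g.2 0 ∧ h.2 1 = g.2 1 := ⟨g, hg, rfl, rfl⟩
  rw [join, dif_pos h]
  obtain ⟨hk, h0, h1⟩ := h.choose_spec
  generalize h.choose = k at *
  have hc : conj (k⁻¹ * g) (x * x) = x * x :=
    conj_of_commute (H.commute_sq (mul_mem (inv_mem hk) hg)
      (Perm.inv_eq_iff_eq.2 h0.symm) (Perm.inv_eq_iff_eq.2 h1.symm))
  conv_lhs => rw [← hc]
  rw [← conj_mul, mul_inv_cancel_left]

lemma conj_join (H : DualSymRelations n x r) {g : Nˣ × Perm ℕ} (hg : g ∈ tailSubgroup n r 0)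
    {i j : ℕ} (hi : i < n) (hj : j < n) (hij : i ≠ j) :
    conj g (join n x r i j) = join n x r (g.2 i) (g.2 j) := by
  obtain ⟨k, hk, rfl, rfl⟩ := exists_map_zero_one (r := r) hi hj hij
  rw [H.join_eq hk, ← conj_mul, ← H.join_eq (mul_mem hg hk)]
  rfl

lemma join_zero_one (H : DualSymRelations n x r) : join n x r 0 1 = x * x := by
  have := H.join_eq (one_mem (tailSubgroup n r 0))
  simpa [conj] using this

lemma join_symm (H : DualSymRelations n x r) {i j : ℕ} (hi : i < n) (hj : j < n) (hij : i ≠ j) :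
    join n x r i j = join n x r j i := by
  obtain ⟨k, hk, rfl, rfl⟩ := exists_map_zero_one (r := r) hi hj hij
  have h4 := H.four_le
  have h0 : gen r 0 ∈ tailSubgroup n r 0 := gen_mem le_rfl (by omega)
  have h := H.join_eq (mul_mem hk h0)
  rw [conj_mul, H.conj_gen (by omega), ← mul_assoc, H.r0_x, mul_assoc, H.x_r0,
    ← H.join_eq hk] at h
  simpa [gen] using h.symm

lemma join_zero_two (H : DualSymRelations n x r) : join n x r 0 2 = r 1 * (x * x) * r 1 := by
  have h4 := H.four_le
  rw [← H.conj_gen (by omega), ← H.join_eq (gen_mem (by omega) (by omega))]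
  congr 1

lemma join_zero_three (H : DualSymRelations n x r) :
    join n x r 0 3 = r 2 * (r 1 * (x * x) * r 1) * r 2 := by
  have h4 := H.four_le
  rw [← H.conj_gen (by omega), ← H.join_zero_two,
    H.conj_join (gen_mem (by omega) (by omega)) (by omega) (by omega) (by omega)]
  congr 1

lemma join_two_three (H : DualSymRelations n x r) :
    join n x r 2 3 = r 1 * r 2 * r 0 * r 1 * (x * x) * (r 1 * r 2 * r 0 * r 1) := by
  have h4 := H.four_le
  have g0 : gen r 0 ∈ tailSubgroup n r 0 := gen_mem (by omega) (by omega)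
  have g1 : gen r 1 ∈ tailSubgroup n r 0 := gen_mem (by omega) (by omega)
  have g2 : gen r 2 ∈ tailSubgroup n r 0 := gen_mem (by omega) (by omega)
  have hc : (r 2 : N) * r 0 = r 0 * r 2 := by
    exact_mod_cast congrArg Units.val (H.comm 0 2 (by omega) (by omega)).symm
  have h := H.join_eq (mul_mem (mul_mem (mul_mem g1 g2) g0) g1)
  simp only [conj_mul, H.conj_gen (show 0 + 1 < n by omega), H.conj_gen (show 1 + 1 < n by omega),
    H.conj_gen (show 2 + 1 < n by omega)] at h
  have e : join n x r 2 3 = _ := h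
  rw [e]
  simp only [mul_assoc]
  rw [← mul_assoc (r 2 : N) (r 0 : N) (r 1 : N), hc, mul_assoc]

lemma sq_mul_join_zero_two (H : DualSymRelations n x r) :
    x * x * join n x r 0 2 = x * r 1 * x := by
  calc x * x * join n x r 0 2 = x * (x * r 1 * x * x) * r 1 := by
        rw [H.join_zero_two]; simp only [mul_assoc]
    _ = x * r 1 * x := by rw [H.xrx_x, H.x_xrx, H.xrx_r]

lemma join_zero_two_mul_sq (H : DualSymRelations n x r) :
    join n x r 0 2 * (x * x) = x * r 1 * x := by
  calc join n x r 0 2 * (x * x) = r 1 * (x * (x * r 1 * x) * x) := by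
        rw [H.join_zero_two]; simp only [mul_assoc]
    _ = x * r 1 * x := by rw [H.x_xrx, H.xrx_x, H.r_xrx]

lemma sq_mul_join_two_three (H : DualSymRelations n x r) :
    x * x * join n x r 2 3 = x * r 1 * r 2 * r 1 * x := by
  rw [← H.disjoint_eq, H.join_two_three]
  simp only [mul_assoc]

lemma commute_sq_join_zero (H : DualSymRelations n x r) {k : ℕ} (hk : 2 ≤ k) (hn : k < n) :
    Commute (x * x) (join n x r 0 k) := by
  obtain ⟨g, hg, e⟩ := exists_swap (r := r) (show 2 < n by omega) hn
  have hsq := conj_of_commute (H.commute_sq hg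
    (by rw [e]; exact swap_apply_of_ne_of_ne (by omega) (by omega))
    (by rw [e]; exact swap_apply_of_ne_of_ne (by omega) (by omega)))
  have hj := H.conj_join hg (show 0 < n by omega) (show 2 < n by omega) (by omega)
  rw [e, swap_apply_left, swap_apply_of_ne_of_ne (by omega) (by omega)] at hj
  rw [Commute, SemiconjBy, ← hj, ← hsq, ← conj_mul_apply, ← conj_mul_apply,
    H.sq_mul_join_zero_two, H.join_zero_two_mul_sq]

lemma commute_sq_join_one (H : DualSymRelations n x r) {k : ℕ} (hk : 2 ≤ k) (hn : k < n) :
    Commute (x * x) (join n x r 1 k) := by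
  have h0 : gen r 0 ∈ tailSubgroup n r 0 := gen_mem le_rfl (by omega)
  have hsq : conj (gen r 0) (x * x) = x * x := by
    rw [H.conj_gen (by omega), ← mul_assoc, H.r0_x, mul_assoc, H.x_r0]
  have hj := H.conj_join h0 (show 0 < n by omega) hn (by omega)
  rw [gen, swap_apply_left, swap_apply_of_ne_of_ne (by omega) (by omega)] at hj
  rw [Commute, SemiconjBy, ← hj, ← hsq, ← gen, ← conj_mul_apply, ← conj_mul_apply,
    (H.commute_sq_join_zero hk hn).eq]

lemma commute_sq_join_two_three (H : DualSymRelations n x r) :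
    Commute (x * x) (join n x r 2 3) := by
  have h := H.disjoint_comm
  rw [Commute, SemiconjBy, H.join_two_three]
  simp only [mul_assoc] at h ⊢
  exact h

lemma commute_sq_join_of_two_le (H : DualSymRelations n x r) {i j : ℕ} (hi : 2 ≤ i) (hj : 2 ≤ j)
    (hin : i < n) (hjn : j < n) (hij : i ≠ j) : Commute (x * x) (join n x r i j) := by
  have h4 := H.four_le
  obtain ⟨g, hg, eg⟩ := exists_swap (r := r) (show 2 < n by omega) hin
  have hne : swap 2 i j ≠ 2 := by
    rw [Ne, swap_apply_eq_iff, swap_apply_left]; exact hij.symm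
  have hge : 2 ≤ swap 2 i j := by rw [swap_apply_def]; split_ifs <;> omega
  have hlt : swap 2 i j < n := eg ▸ apply_lt hg hjn
  obtain ⟨h, hh, eh⟩ := exists_swap (r := r) (show 3 < n by omega) hlt
  have hgh := mul_mem hg hh
  have hfix : ∀ a < 2, (g * h).2 a = a := fun a ha => by
    rw [Prod.snd_mul, Perm.mul_apply, eg, eh,
      swap_apply_of_ne_of_ne (x := a) (by omega) (by omega),
      swap_apply_of_ne_of_ne (by omega) (by omega)]
  have hsq := conj_of_commute (H.commute_sq hgh (hfix 0 (by omega)) (hfix 1 (by omega)))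
  have hc := H.conj_join hgh (show 2 < n by omega) (show 3 < n by omega) (by omega)
  rw [Prod.snd_mul, Perm.mul_apply, Perm.mul_apply, eg, eh, swap_apply_left, swap_apply_self,
    swap_apply_of_ne_of_ne (by omega) hne.symm, swap_apply_left] at hc
  rw [Commute, SemiconjBy, ← hc, ← hsq, ← conj_mul_apply, ← conj_mul_apply,
    H.commute_sq_join_two_three.eq]

lemma commute_sq_join (H : DualSymRelations n x r) {i j : ℕ} (hin : i < n) (hjn : j < n)
    (hij : i ≠ j) : Commute (x * x) (join n x r i j) := by
  wlog h : i < j generalizing i j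
  · rw [H.join_symm hin hjn hij]
    exact this hjn hin hij.symm (by omega)
  rcases (show i = 0 ∧ j = 1 ∨ i = 0 ∧ 2 ≤ j ∨ i = 1 ∧ 2 ≤ j ∨ 2 ≤ i by omega) with
    ⟨rfl, rfl⟩ | ⟨rfl, hj⟩ | ⟨rfl, hj⟩ | hi
  · rw [H.join_zero_one]
  · exact H.commute_sq_join_zero hj hjn
  · exact H.commute_sq_join_one hj hjn
  · exact H.commute_sq_join_of_two_le hi (by omega) hin hjn hij

/-- The submonoid generated by the idempotents `join i j`. -/
def joinSubmonoid (n : ℕ) (x : N) (r : ℕ → Nˣ) : Submonoid N :=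
  Submonoid.closure {y | ∃ i j, i < n ∧ j < n ∧ i ≠ j ∧ y = join n x r i j}

lemma join_mem {i j : ℕ} (hi : i < n) (hj : j < n) (hij : i ≠ j) :
    join n x r i j ∈ joinSubmonoid n x r :=
  Submonoid.subset_closure ⟨i, j, hi, hj, hij, rfl⟩

lemma sq_mem (H : DualSymRelations n x r) : x * x ∈ joinSubmonoid n x r := by
  have := H.four_le
  exact H.join_zero_one ▸ join_mem (by omega) (by omega) (by omega)

lemma commute_sq_of_mem (H : DualSymRelations n x r) {e : N} (he : e ∈ joinSubmonoid n x r) :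
    Commute (x * x) e := by
  induction he using Submonoid.closure_induction with
  | mem y hy =>
    obtain ⟨i, j, hi, hj, hij, rfl⟩ := hy
    exact H.commute_sq_join hi hj hij
  | one => exact Commute.one_right _
  | mul a b _ _ iha ihb => exact iha.mul_right ihb

lemma conj_mem (H : DualSymRelations n x r) {g : Nˣ × Perm ℕ} (hg : g ∈ tailSubgroup n r 0)
    {e : N} (he : e ∈ joinSubmonoid n x r) : conj g e ∈ joinSubmonoid n x r := by
  induction he using Submonoid.closure_induction with
  | mem y hy =>
    obtain ⟨i, j, hi, hj, hij, rfl⟩ := hy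
    rw [H.conj_join hg hi hj hij]
    exact join_mem (apply_lt hg hi) (apply_lt hg hj) (g.2.injective.ne hij)
  | one => simp [conj]
  | mul a b _ _ iha ihb => exact conj_mul_apply g a b ▸ mul_mem iha ihb

lemma x_join_zero_two_x (H : DualSymRelations n x r) :
    x * join n x r 0 2 * x = x * x * join n x r 0 2 := by
  rw [H.sq_mul_join_zero_two, H.join_zero_two]
  calc x * (r 1 * (x * x) * r 1) * x = x * r 1 * x * x * r 1 * x := by simp only [mul_assoc]
    _ = x * r 1 * x := by rw [H.xrx_x, H.xrx_r, H.xrx_x]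

lemma x_join_two_three_x (H : DualSymRelations n x r) :
    x * join n x r 2 3 * x = x * x * join n x r 0 3 := by
  have h4 := H.four_le
  have hb : (r 1 : N) * r 2 * r 1 = r 2 * r 1 * r 2 := by
    exact_mod_cast congrArg Units.val (H.braid 1 (by omega))
  have hs : x * x * r 2 = r 2 * (x * x) := H.sq_r2.eq.symm
  have hz := H.sq_mul_join_zero_two
  rw [H.join_zero_two] at hz
  have hz' : x * x * (r 1 * (x * x)) = x * r 1 * x := by
    rw [mul_assoc, ← mul_assoc (r 1 : N), ← mul_assoc x (r 1 * x), ← mul_assoc x (r 1 : N) x,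
      H.xrx_x, H.x_xrx]
  calc x * join n x r 2 3 * x = x * (x * x) * join n x r 2 3 * x := by rw [H.x_cube]
    _ = x * (x * x * join n x r 2 3) * x := by simp only [mul_assoc]
    _ = x * x * (r 1 * r 2 * r 1) * (x * x) := by
        rw [H.sq_mul_join_two_three]; simp only [mul_assoc]
    _ = x * x * r 2 * r 1 * (r 2 * (x * x)) := by rw [hb]; simp only [mul_assoc]
    _ = x * x * r 2 * (r 1 * (x * x) * r 2) := by rw [H.sq_r2.eq]; simp only [mul_assoc]
    _ = r 2 * (x * x * (r 1 * (x * x))) * r 2 := by rw [hs]; simp only [mul_assoc]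
    _ = r 2 * (x * x * (r 1 * (x * x) * r 1)) * r 2 := by rw [hz', hz]
    _ = r 2 * (x * x) * (r 1 * (x * x) * r 1) * r 2 := by simp only [mul_assoc]
    _ = x * x * join n x r 0 3 := by rw [← hs, H.join_zero_three]; simp only [mul_assoc]

lemma x_join_zero_three_x (H : DualSymRelations n x r) :
    x * join n x r 0 3 * x = x * x * join n x r 2 3 * (x * x * join n x r 2 3) := by
  have h4 := H.four_le
  have hb : (r 1 : N) * r 2 * r 1 = r 2 * r 1 * r 2 := by
    exact_mod_cast congrArg Units.val (H.braid 1 (by omega))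
  have hs : r 2 * (x * x) * r 2 = x * x := by
    rw [H.sq_r2.eq, mul_assoc, H.r_sq (by omega), mul_one]
  rw [H.sq_mul_join_two_three, H.join_zero_three]
  calc x * (r 2 * (r 1 * (x * x) * r 1) * r 2) * x
      = x * (r 2 * (r 1 * (r 2 * (x * x) * r 2) * r 1) * r 2) * x := by rw [hs]
    _ = x * (r 2 * r 1 * r 2) * (x * x) * (r 2 * r 1 * r 2) * x := by simp only [mul_assoc]
    _ = x * r 1 * r 2 * r 1 * x * (x * r 1 * r 2 * r 1 * x) := by
        rw [← hb]; simp only [mul_assoc]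

lemma x_conj_x {g : Nˣ × Perm ℕ} (h : Commute (g.1 : N) x) (y : N) :
    x * conj g y * x = conj g (x * y * x) := by
  rw [conj_mul_apply, conj_mul_apply, conj_of_commute h]

lemma exists_swap_commute_x (H : DualSymRelations n x r) {k : ℕ} (hk : 3 ≤ k) (hn : k < n) :
    ∃ g ∈ tailSubgroup n r 0, g.2 = swap 3 k ∧ Commute (g.1 : N) x := by
  obtain ⟨g, hg, e⟩ := exists_swap (r := r) (show 3 < n by omega) hn
  refine ⟨g, hg, e, H.commute_x hg fun a ha => ?_⟩
  rw [e, swap_apply_of_ne_of_ne (by omega) (by omega)]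

lemma x_join_two_x (H : DualSymRelations n x r) {k : ℕ} (hk : 3 ≤ k) (hn : k < n) :
    x * join n x r 2 k * x = x * x * join n x r 0 k := by
  obtain ⟨g, hg, e, hc⟩ := H.exists_swap_commute_x hk hn
  have h2 := H.conj_join hg (show 2 < n by omega) (show 3 < n by omega) (by omega)
  have h0 := H.conj_join hg (show 0 < n by omega) (show 3 < n by omega) (by omega)
  rw [e, swap_apply_left, swap_apply_of_ne_of_ne (by omega) (by omega)] at h2 h0
  rw [← h2, x_conj_x hc, H.x_join_two_three_x, conj_mul_apply,
    conj_of_commute (hc.mul_right hc), h0]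

lemma x_join_zero_x_mem (H : DualSymRelations n x r) {k : ℕ} (hk : 3 ≤ k) (hn : k < n) :
    x * join n x r 0 k * x ∈ joinSubmonoid n x r := by
  obtain ⟨g, hg, e, hc⟩ := H.exists_swap_commute_x hk hn
  have h0 := H.conj_join hg (show 0 < n by omega) (show 3 < n by omega) (by omega)
  rw [e, swap_apply_left, swap_apply_of_ne_of_ne (by omega) (by omega)] at h0
  rw [← h0, x_conj_x hc, H.x_join_zero_three_x]
  have hm := mul_mem H.sq_mem (join_mem (x := x) (r := r) (show 2 < n by omega)
    (show 3 < n by omega) (by omega))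
  exact H.conj_mem hg (mul_mem hm hm)

lemma x_join_three_x_mem (H : DualSymRelations n x r) {k : ℕ} (hk : 4 ≤ k) (hn : k < n) :
    x * join n x r 3 k * x ∈ joinSubmonoid n x r := by
  have g2 : gen r 2 ∈ tailSubgroup n r 0 := gen_mem (by omega) (by omega)
  have h2 := H.conj_join g2 (show 2 < n by omega) hn (by omega)
  rw [gen, swap_apply_left, swap_apply_of_ne_of_ne (by omega) (by omega), ← gen,
    H.conj_gen (by omega)] at h2
  have hx : r 2 * (x * r 2 * x * r 2) = x := by
    rw [H.x_r2_x_r2, H.r_mul_cancel (by omega)]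
  have hs : r 2 * (x * x) = x * x * r 2 := H.sq_r2.eq
  have key : x * join n x r 3 k * x = conj (gen r 2) (x * join n x r 0 k * x) := by
    rw [H.conj_gen (by omega)]
    calc x * join n x r 3 k * x
        = x * (r 2 * join n x r 2 k * r 2) * (r 2 * (x * r 2 * x * r 2)) := by rw [hx, h2]
      _ = x * r 2 * join n x r 2 k * (r 2 * (r 2 * (x * r 2 * x * r 2))) := by
          simp only [mul_assoc]
      _ = r 2 * x * r 2 * (x * join n x r 2 k * x) * (r 2 * x * r 2) := by
          rw [H.r_mul_cancel (by omega)]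
          conv_lhs => arg 1; rw [← H.r2_x_r2_x]
          simp only [mul_assoc]
      _ = r 2 * x * (r 2 * (x * x)) * join n x r 0 k * (r 2 * x * r 2) := by
          rw [H.x_join_two_x (by omega) hn]; simp only [mul_assoc]
      _ = r 2 * (x * (x * x)) * r 2 * join n x r 0 k * (r 2 * x * r 2) := by
          rw [hs]; simp only [mul_assoc]
      _ = r 2 * x * (r 2 * join n x r 0 k * r 2) * x * r 2 := by
          rw [H.x_cube]; simp only [mul_assoc]
      _ = r 2 * (x * join n x r 0 k * x) * r 2 := by
          have h0 := H.conj_join g2 (show 0 < n by omega) hn (by omega)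
          rw [gen, swap_apply_of_ne_of_ne (by omega) (by omega),
            swap_apply_of_ne_of_ne (by omega) (by omega), ← gen, H.conj_gen (by omega)] at h0
          rw [h0]; simp only [mul_assoc]
  rw [key]
  exact H.conj_mem g2 (H.x_join_zero_x_mem (by omega) hn)

lemma x_join_one_x (H : DualSymRelations n x r) {k : ℕ} (hk : 2 ≤ k) (hn : k < n) :
    x * join n x r 1 k * x = x * join n x r 0 k * x := by
  have h0 := H.conj_join (gen_mem (r := r) le_rfl (show 0 + 1 < n by omega))
    (show 0 < n by omega) hn (by omega)
  rw [gen, swap_apply_left, swap_apply_of_ne_of_ne (by omega) (by omega), ← gen,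
    H.conj_gen (by omega)] at h0
  calc x * join n x r 1 k * x = x * r 0 * join n x r 0 k * (r 0 * x) := by
        rw [← h0]; simp only [mul_assoc]
    _ = x * join n x r 0 k * x := by rw [H.x_r0, H.r0_x]

lemma x_join_x_mem (H : DualSymRelations n x r) {i j : ℕ} (hin : i < n) (hjn : j < n)
    (hij : i ≠ j) : x * join n x r i j * x ∈ joinSubmonoid n x r := by
  wlog h : i < j generalizing i j
  · rw [H.join_symm hin hjn hij]
    exact this hjn hin hij.symm (by omega)
  have zero_case : ∀ k, 2 ≤ k → k < n → x * join n x r 0 k * x ∈ joinSubmonoid n x r := by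
    intro k hk hn
    rcases hk.eq_or_lt with rfl | hk
    · rw [H.x_join_zero_two_x]
      exact mul_mem H.sq_mem (join_mem (by omega) hn (by omega))
    · exact H.x_join_zero_x_mem hk hn
  rcases (show i = 0 ∧ j = 1 ∨ i = 0 ∧ 2 ≤ j ∨ i = 1 ∧ 2 ≤ j ∨ i = 2 ∧ 3 ≤ j ∨ 3 ≤ i by omega)
    with ⟨rfl, rfl⟩ | ⟨rfl, hj⟩ | ⟨rfl, hj⟩ | ⟨rfl, hj⟩ | hi
  · rw [H.join_zero_one, H.x_cube]
    exact H.sq_mem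
  · exact zero_case j hj hjn
  · rw [H.x_join_one_x hj hjn]
    exact zero_case j hj hjn
  · rw [H.x_join_two_x hj hjn]
    exact mul_mem H.sq_mem (join_mem (by omega) hjn (by omega))
  · obtain ⟨g, hg, e, hc⟩ := H.exists_swap_commute_x hi hin
    have hj := H.conj_join hg (show 3 < n by omega) hjn (by omega)
    rw [e, swap_apply_left, swap_apply_of_ne_of_ne (by omega) (by omega)] at hj
    rw [← hj, x_conj_x hc]
    exact H.conj_mem hg (H.x_join_three_x_mem (by omega) hjn)

lemma x_mul_mul_x_mem (H : DualSymRelations n x r) {e : N} (he : e ∈ joinSubmonoid n x r) :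
    x * e * x ∈ joinSubmonoid n x r := by
  induction he using Submonoid.closure_induction with
  | mem y hy =>
    obtain ⟨i, j, hi, hj, hij, rfl⟩ := hy
    exact H.x_join_x_mem hi hj hij
  | one => rw [mul_one]; exact H.sq_mem
  | mul a b ha _ iha ihb =>
    have : x * (a * b) * x = x * a * x * (x * b * x) := by
      calc x * (a * b) * x = x * (x * x) * (a * b) * x := by rw [H.x_cube]
        _ = x * (x * x * a) * b * x := by simp only [mul_assoc]
        _ = x * a * x * (x * b * x) := by
            rw [(H.commute_sq_of_mem ha).eq]; simp only [mul_assoc]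
    exact this ▸ mul_mem iha ihb

/-- Letters of the alphabet: `x`, or one of the units `r i`. -/
def IsLetter (n : ℕ) (x : N) (r : ℕ → Nˣ) (a : N) : Prop :=
  a = x ∨ ∃ i, i + 1 < n ∧ a = r i

lemma letter_mul_mul_letter_mem (H : DualSymRelations n x r) {a e : N} (ha : IsLetter n x r a)
    (he : e ∈ joinSubmonoid n x r) : a * e * a ∈ joinSubmonoid n x r := by
  obtain rfl | ⟨i, hi, rfl⟩ := ha
  · exact H.x_mul_mul_x_mem he
  · exact H.conj_gen hi e ▸ H.conj_mem (gen_mem (Nat.zero_le i) hi) he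

lemma letter_cube (H : DualSymRelations n x r) {a : N} (ha : IsLetter n x r a) :
    a * (a * a) = a := by
  obtain rfl | ⟨i, hi, rfl⟩ := ha
  · exact H.x_cube
  · exact H.r_mul_cancel hi _

lemma commute_letter_sq (H : DualSymRelations n x r) {a e : N} (ha : IsLetter n x r a)
    (he : e ∈ joinSubmonoid n x r) : Commute (a * a) e := by
  obtain rfl | ⟨i, hi, rfl⟩ := ha
  · exact H.commute_sq_of_mem he
  · rw [H.r_sq hi]
    exact Commute.one_left _

lemma prod_mul_prod_reverse (H : DualSymRelations n x r) (l : List N)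
    (hl : ∀ a ∈ l, IsLetter n x r a) :
    l.prod * l.reverse.prod ∈ joinSubmonoid n x r ∧ l.prod * l.reverse.prod * l.prod = l.prod := by
  induction l with
  | nil => simp
  | cons a l ih =>
    obtain ⟨hmem, hreg⟩ := ih fun b hb => hl b (List.mem_cons_of_mem a hb)
    have ha := hl a List.mem_cons_self
    simp only [List.reverse_cons, List.prod_cons, List.prod_append, List.prod_nil, mul_one]
    constructor
    · simpa only [mul_assoc] using H.letter_mul_mul_letter_mem ha hmem
    · calc a * l.prod * (l.reverse.prod * a) * (a * l.prod)
          = a * (l.prod * l.reverse.prod * (a * a)) * l.prod := by simp only [mul_assoc]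
        _ = a * (a * a) * (l.prod * l.reverse.prod * l.prod) := by
            rw [← (H.commute_letter_sq ha hmem).eq]; simp only [mul_assoc]
        _ = a * l.prod := by rw [H.letter_cube ha, hreg]

end DualSymRelations

lemma mk_eq_of_rel {n : ℕ} {u v : FreeMonoid (Fin n)} (h : MRel n u v) :
    (Mcon n).mk' u = (Mcon n).mk' v :=
  (Con.eq _).2 (ConGen.Rel.of _ _ h)

lemma sm_sq {n i : ℕ} (h1 : 1 ≤ i) (hi : i < n) : sm n i * sm n i = 1 := by
  have h := mk_eq_of_rel (MRel.r1 (n := n) h1 le_rfl (by omega))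
  simpa [mExp, sm] using h

/-- The generator `s_{i+1}` of `Mₙ` as a unit. -/
def smUnit (n i : ℕ) : (M n)ˣ :=
  if h : i + 1 < n then ⟨sm n (i + 1), sm n (i + 1), sm_sq (by omega) h, sm_sq (by omega) h⟩ else 1

lemma coe_smUnit {n i : ℕ} (h : i + 1 < n) : (smUnit n i : M n) = sm n (i + 1) := by
  rw [smUnit, dif_pos h]

lemma smUnit_sq {n i : ℕ} (h : i + 1 < n) : smUnit n i * smUnit n i = 1 := by
  ext
  rw [Units.val_mul, coe_smUnit h, sm_sq (by omega) h, Units.val_one]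

lemma smUnit_mul_pow {n i j : ℕ} (hij : i ≤ j) (h : j + 1 < n) :
    (smUnit n i * smUnit n j) ^ mExp (i + 1) (j + 1) = 1 := by
  ext
  rw [Units.val_pow_eq_pow_val, Units.val_mul, coe_smUnit h, coe_smUnit (by omega)]
  have h := mk_eq_of_rel (MRel.r1 (n := n) (i := i + 1) (j := j + 1) (by omega) (by omega)
    (by omega))
  rwa [map_pow, map_mul, map_one] at h

lemma dualSymRelations {n : ℕ} (hn : 4 ≤ n) : DualSymRelations n (xm n) (smUnit n) where
  four_le := hn
  sq i hi := smUnit_sq hi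
  comm i j hij hj := by
    have h := smUnit_mul_pow (n := n) (show i ≤ j by omega) hj
    rw [mExp, if_neg (by omega), if_neg (by omega), pow_two] at h
    have hi' := inv_eq_of_mul_eq_one_left (smUnit_sq (n := n) (i := i) (by omega))
    have hj' := inv_eq_of_mul_eq_one_left (smUnit_sq hj)
    have := eq_inv_of_mul_eq_one_left h
    rwa [mul_inv_rev, hi', hj'] at this
  braid i hi := by
    have h := smUnit_mul_pow (n := n) (show i ≤ i + 1 by omega) hi
    rw [mExp, if_neg (by omega), if_pos (by omega), pow_succ, pow_two] at h
    have hi' := inv_eq_of_mul_eq_one_left (smUnit_sq (n := n) (i := i) (by omega))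
    have hj' := inv_eq_of_mul_eq_one_left (smUnit_sq (n := n) (i := i + 1) hi)
    have : smUnit n i * smUnit n (i + 1) * smUnit n i
        * (smUnit n (i + 1) * smUnit n i * smUnit n (i + 1)) = 1 := by
      simpa only [mul_assoc] using h
    have := eq_inv_of_mul_eq_one_left this
    rwa [mul_inv_rev, mul_inv_rev, hi', hj', ← mul_assoc] at this
  x_cube := by
    have h := mk_eq_of_rel (MRel.r2 (n := n))
    simpa [xm, pow_succ, mul_assoc] using h
  x_r0 := by
    rw [coe_smUnit (by omega)]
    simpa [xm, sm] using mk_eq_of_rel (MRel.r3a (n := n))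
  r0_x := by
    rw [coe_smUnit (by omega)]
    simpa [xm, sm] using mk_eq_of_rel (MRel.r3b (n := n))
  xrx_r := by
    rw [coe_smUnit (by omega)]
    simpa [xm, sm] using (mk_eq_of_rel (MRel.r4a (n := n))).symm
  r_xrx := by
    rw [coe_smUnit (by omega)]
    simpa [xm, sm, mul_assoc] using (mk_eq_of_rel (MRel.r4b (n := n))).symm
  xrx_x := by
    rw [coe_smUnit (by omega)]
    simpa [xm, sm, mul_assoc, pow_two] using (mk_eq_of_rel (MRel.r4c (n := n))).symm
  x_xrx := by
    rw [coe_smUnit (by omega)]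
    simpa [xm, sm, mul_assoc, pow_two] using (mk_eq_of_rel (MRel.r4d (n := n))).symm
  disjoint_comm := by
    rw [coe_smUnit (by omega), coe_smUnit (by omega), coe_smUnit (by omega)]
    simpa [xm, sm, σw, mul_assoc, pow_two] using mk_eq_of_rel (MRel.r5a hn)
  disjoint_eq := by
    rw [coe_smUnit (by omega), coe_smUnit (by omega), coe_smUnit (by omega)]
    simpa [xm, sm, σw, mul_assoc, pow_two] using mk_eq_of_rel (MRel.r5b hn)
  x_braid := by
    rw [coe_smUnit (by omega)]
    simpa [xm, sm, yw] using mk_eq_of_rel (MRel.r6 (n := n) (i := 3) le_rfl (by omega))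
  x_comm i hi hin := by
    rw [coe_smUnit hin]
    simpa [xm, sm] using mk_eq_of_rel (MRel.r7 (n := n) (i := i + 1) (by omega) (by omega))

lemma isLetter_mk_of {n : ℕ} (i : Fin n) :
    DualSymRelations.IsLetter n (xm n) (smUnit n) ((Mcon n).mk' (FreeMonoid.of i)) := by
  obtain ⟨i, hi⟩ := i
  cases i with
  | zero => exact Or.inl (by rw [xm, xw, dif_pos hi])
  | succ i => exact Or.inr ⟨i, hi, by rw [coe_smUnit hi, sm, sw, dif_pos hi]⟩

lemma mk_eq_prod {n : ℕ} (u : FreeMonoid (Fin n)) :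
    (Mcon n).mk' u = (u.toList.map fun i => (Mcon n).mk' (FreeMonoid.of i)).prod := by
  induction u using FreeMonoid.inductionOn' with
  | one => simp
  | of_mul i u ih =>
    rw [map_mul, ih, FreeMonoid.toList_of_mul, List.map_cons, List.prod_cons]

/-- For `n ≥ 4`, if an element `w` of `Mₙ` is the image of a word
over the alphabet `{x, s₁, …, s_{n-1}}` that is equal to its own reverse, then
`w³ = w` and `w²` is idempotent. -/
theorem stmt14 (n : ℕ) (hn : 4 ≤ n) (u : FreeMonoid (Fin n))
    (hu : FreeMonoid.toList u = (FreeMonoid.toList u).reverse) (w : M n)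
    (hw : w = (Mcon n).mk' u) :
    w ^ 3 = w ∧ IsIdempotentElem (w ^ 2) := by
  have h := ((dualSymRelations hn).prod_mul_prod_reverse
    (u.toList.map fun i => (Mcon n).mk' (FreeMonoid.of i)) (by
      intro a ha
      obtain ⟨i, -, rfl⟩ := List.mem_map.1 ha
      exact isLetter_mk_of i)).2
  rw [← List.map_reverse, ← hu, ← mk_eq_prod, ← hw] at h
  have h3 : w ^ 3 = w := by rw [pow_succ, pow_two, h]
  refine ⟨h3, ?_⟩
  rw [IsIdempotentElem, ← pow_add, show 2 + 2 = 3 + 1 from rfl, pow_succ, h3, pow_two]
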